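/- Tangency of unit spheres: if J ∈ V is tangent to the unit F-sphere at a point ξ (i.e. d F_ξ(J) = 0 where F(ξ) = 1), then J is tangent to the unit F̃-sphere at ξ + v, i.e. d F̃_{ξ+v}(J) = 0. -/

import Mathlib

open Set

/-- tangency of unit spheres: if `J` is tangent to the unit
`F`-sphere at `ξ` (i.e. `dF_ξ(J) = 0` with `F ξ = 1`), then `J` is tangent to
the unit `F̃`-sphere at `ξ + v`, i.e. `dF̃_{ξ+v}(J) = 0`. -/
theorem zermelo_tangency_of_unit_spheres
    {n : ℕ} (F Ft : (Fin n → ℝ) → ℝ) (v : Fin n → ℝ)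
    (hFsm : ContDiffOn ℝ (⊤ : ℕ∞) F {(0 : Fin n → ℝ)}ᶜ)
    (hhom : ∀ c : ℝ, 0 < c → ∀ ξ, F (c • ξ) = c * F ξ)
    (hpos : ∀ ξ : Fin n → ℝ, ξ ≠ 0 → 0 < F ξ)
    (hconv : ConvexOn ℝ univ F)
    (hv : F (-v) < 1)
    (hFtpos : ∀ ξ : Fin n → ℝ, ξ ≠ 0 → 0 < Ft ξ)
    (hFteq : ∀ ξ : Fin n → ℝ, ξ ≠ 0 → Ft ξ = F (ξ - Ft ξ • v))
    (ξ : Fin n → ℝ) (hξ : F ξ = 1)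
    (hFtdiff : DifferentiableAt ℝ Ft (ξ + v))
    (J : Fin n → ℝ) (hJ : fderiv ℝ F ξ J = 0) :
    fderiv ℝ Ft (ξ + v) J = 0 := by
  have h0 : F 0 = 0 := by
    have := hhom 2 (by norm_num) 0
    rw [smul_zero] at this
    linarith
  have hsub : ∀ a b, F (a + b) ≤ F a + F b := by
    intro a b
    have h1 := hconv.2 (mem_univ a) (mem_univ b)
      (by norm_num : (0 : ℝ) ≤ 1 / 2) (by norm_num : (0 : ℝ) ≤ 1 / 2) (by norm_num)
    rw [← smul_add, hhom _ (by norm_num)] at h1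
    simp only [smul_eq_mul] at h1
    linarith
  have hξ0 : ξ ≠ 0 := by
    rintro rfl
    linarith
  have hξv : ξ + v ≠ 0 := by
    intro h
    rw [eq_neg_of_add_eq_zero_left h] at hξ
    linarith
  have hFt1 : Ft (ξ + v) = 1 := by
    have ht := hFtpos _ hξv
    have he := hFteq _ hξv
    generalize Ft (ξ + v) = t at ht he
    rcases lt_trichotomy t 1 with h | h | h
    · have h1 := hsub (ξ + v - t • v) ((1 - t) • (-v))
      rw [hhom _ (by linarith), ← he] at h1
      have h2 : ξ + v - t • v + (1 - t) • (-v) = ξ := by module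
      rw [h2, hξ] at h1
      nlinarith
    · exact h
    · have h1 := hsub ξ ((t - 1) • (-v))
      rw [hhom _ (by linarith), hξ] at h1
      have h2 : ξ + (t - 1) • (-v) = ξ + v - t • v := by module
      rw [h2, ← he] at h1
      nlinarith
  have hFd : HasFDerivAt F (fderiv ℝ F ξ) ξ :=
    ((hFsm.contDiffAt (isOpen_compl_singleton.mem_nhds hξ0)).differentiableAt
      (by simp)).hasFDerivAt
  have hdv : fderiv ℝ F ξ (-v) ≤ F (-v) := by
    have hl : HasDerivAt (fun s : ℝ => ξ + s • (-v)) (-v) 0 := by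
      simpa using ((hasDerivAt_id (0 : ℝ)).smul_const (-v)).const_add ξ
    have hg : HasDerivAt (fun s : ℝ => F (ξ + s • (-v))) (fderiv ℝ F ξ (-v)) 0 := by
      have hF' : HasFDerivAt F (fderiv ℝ F ξ) (ξ + (0 : ℝ) • (-v)) := by simpa using hFd
      exact hF'.comp_hasDerivAt (0 : ℝ) hl
    have hc : ConvexOn ℝ univ (fun s : ℝ => F (ξ + s • (-v))) := by
      refine ⟨convex_univ, ?_⟩
      intro x _ y _ a b ha hb hab
      have := hconv.2 (mem_univ (ξ + x • (-v))) (mem_univ (ξ + y • (-v))) ha hb hab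
      have h2 : a • (ξ + x • (-v)) + b • (ξ + y • (-v)) = ξ + (a • x + b • y) • (-v) := by
        obtain rfl : b = 1 - a := by linarith
        simp only [smul_eq_mul]
        module
      rwa [h2] at this
    have h3 := hc.le_slope_of_hasDerivAt (mem_univ 0) (mem_univ 1) zero_lt_one hg
    simp only [slope_def_field, zero_smul, one_smul, add_zero, sub_zero, div_one] at h3
    have := hsub ξ (-v)
    linarith
  have hG := hFtdiff.hasFDerivAt
  have hin : HasFDerivAt (fun x => x - Ft x • v)
      (ContinuousLinearMap.id ℝ (Fin n → ℝ) - (fderiv ℝ Ft (ξ + v)).smulRight v) (ξ + v) :=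
    (hasFDerivAt_id _).sub (hG.smul_const v)
  have hcomp : HasFDerivAt (fun x => F (x - Ft x • v)) ((fderiv ℝ F ξ).comp
      (ContinuousLinearMap.id ℝ (Fin n → ℝ) - (fderiv ℝ Ft (ξ + v)).smulRight v)) (ξ + v) := by
    have hF' : HasFDerivAt F (fderiv ℝ F ξ) ((ξ + v) - Ft (ξ + v) • v) := by
      simpa [hFt1] using hFd
    exact hF'.comp (ξ + v) hin
  have hev : Ft =ᶠ[nhds (ξ + v)] (fun x => F (x - Ft x • v)) := by
    filter_upwards [isOpen_compl_singleton.mem_nhds hξv] with x hx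
    exact hFteq x hx
  have hu := hG.unique (hcomp.congr_of_eventuallyEq hev)
  have hJ2 := DFunLike.congr_fun hu J
  simp only [ContinuousLinearMap.comp_apply, sub_apply,
    ContinuousLinearMap.id_apply, ContinuousLinearMap.smulRight_apply, map_sub, map_smul,
    hJ, smul_eq_mul] at hJ2
  rw [map_neg] at hdv
  have h5 : fderiv ℝ Ft (ξ + v) J * (1 + fderiv ℝ F ξ v) = 0 := by linarith
  rcases mul_eq_zero.1 h5 with h | h
  · exact h
  · linarith
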